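/- arXiv:0809.4322 — 5 statements merged into one kernel-verified Lean document; each statement's English description precedes it below -/
import Mathlib

section
/- Let $I$ be a set and $u$ a countably incomplete ultrafilter on $I$, i.e. there is a decreasing sequence of sets $I = I_0 \supseteq I_1 \supseteq I_2 \supseteq \dots$ with each $I_n \in u$ and $\bigcap_{n} I_n = \varnothing$. Let $(\mathbb{F}_{n,i})_{n \in \mathbb{N}, i \in I}$ be a family of sets of smooth functions, $\mathbb{F}_{n,i} \subseteq \mathcal{C}^\infty(\mathbb{R}^d, \mathbb{C})$, and suppose that for every $m \in \mathbb{N}$ there exists a family $f : I \to (\mathbb{R}^d \to \mathbb{C})$ of smooth functions such that for every $n \le m$, $\{ i \in I \mid f(i) \in \mathbb{F}_{n,i} \} \in u$. Then there exists $g : I \to (\mathbb{R}^d \to \mathbb{C})$, each $g(i)$ smooth, such that for every $n \in \mathbb{N}$, $\{ i \in I \mid g(i) \in \mathbb{F}_{n,i} \} \in u$. -/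
open Classical in
/-- If a filter contains a decreasing sequence of sets with empty intersection, then any sequence
`S` of members of the filter admits a selector `k` which tends to infinity along the filter and
satisfies `i ∈ S (k i)` eventually. -/
theorem Filter.exists_selector_of_iInter_eq_empty {I : Type*} (l : Filter I)
    (A : ℕ → Set I) (hA : Antitone A) (hAl : ∀ n, A n ∈ l) (hA0 : ⋂ n, A n = ∅)
    (S : ℕ → Set I) (hS : ∀ n, S n ∈ l) :
    ∃ k : I → ℕ, ∀ n, ∀ᶠ i in l, n ≤ k i ∧ i ∈ S (k i) := by
  have hN : ∀ i, ∃ N, i ∉ A N := fun i => by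
    simpa using Set.eq_empty_iff_forall_notMem.mp hA0 i
  choose N hN using hN
  refine ⟨fun i => Nat.findGreatest (fun m => i ∈ S m) (N i), fun n => ?_⟩
  filter_upwards [hAl n, hS n] with i hiA hiS
  have hn : n ≤ N i := le_of_not_ge fun h => hN i (hA h hiA)
  exact ⟨Nat.le_findGreatest hn hiS, Nat.findGreatest_spec (P := fun m => i ∈ S m) hn hiS⟩


/-- Saturation Principle in `*𝓔(ℝᵈ)`: for a countably incomplete ultrafilter `u` on `I`,
a sequence of internal sets of smooth functions with the finite intersection property
has nonempty intersection. -/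
theorem saturation_principle_starE {I : Type*} (d : ℕ) (u : Ultrafilter I)
    (Is : ℕ → Set I) (hI0 : Is 0 = Set.univ) (hanti : Antitone Is)
    (hmem : ∀ n, Is n ∈ u) (hinter : ⋂ n, Is n = ∅)
    (F : ℕ → I → Set (EuclideanSpace ℝ (Fin d) → ℂ))
    (hsub : ∀ n i, ∀ f ∈ F n i, ContDiff ℝ (⊤ : ℕ∞) f)
    (hfin : ∀ m : ℕ, ∃ f : I → (EuclideanSpace ℝ (Fin d) → ℂ),
      (∀ i, ContDiff ℝ (⊤ : ℕ∞) (f i)) ∧ ∀ n ≤ m, {i | f i ∈ F n i} ∈ u) :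
    ∃ g : I → (EuclideanSpace ℝ (Fin d) → ℂ),
      (∀ i, ContDiff ℝ (⊤ : ℕ∞) (g i)) ∧ ∀ n : ℕ, {i | g i ∈ F n i} ∈ u := by
  choose f hf hfF using hfin
  obtain ⟨k, hk⟩ := Filter.exists_selector_of_iInter_eq_empty (u : Filter I) Is hanti hmem hinter
    (fun m => {i | ∀ n ≤ m, f m i ∈ F n i})
    (fun m => (Filter.eventually_all_finite (Set.finite_Iic m)).mpr (hfF m))
  refine ⟨fun i => f (k i) i, fun i => hf (k i) i, fun n => ?_⟩
  filter_upwards [hk n] with i hi using hi.2 n hi.1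
end

section
/- Let $u$ be an ultrafilter on a nonempty set $I$ and let ${}^*\mathbb{C} = \mathrm{Germ}(u, \mathbb{C})$ be the ultrapower of $\mathbb{C}$ with respect to $u$ (a field). Then ${}^*\mathbb{C}$ is algebraically closed: every polynomial $P \in {}^*\mathbb{C}[X]$ with $\deg P \ge 1$ has a root in ${}^*\mathbb{C}$. -/
theorem Filter.Germ.exists_eval_eq_zero {I K : Type*} [Field K] [IsAlgClosed K]
    (u : Ultrafilter I) (P : Polynomial (Filter.Germ (u : Filter I) K)) (hP : 1 ≤ P.degree) :
    ∃ x : Filter.Germ (u : Filter I) K, P.eval x = 0 := by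
  have hsurj : Function.Surjective (Filter.Germ.coeRingHom (R := K) (u : Filter I)) :=
    fun g => Filter.Germ.inductionOn g fun f => ⟨f, rfl⟩
  obtain ⟨Q, rfl⟩ := Polynomial.map_surjective _ hsurj P
  set P := Q.map (Filter.Germ.coeRingHom (u : Filter I))
  have hn : 0 < P.natDegree :=
    Polynomial.natDegree_pos_iff_degree_pos.2 (zero_lt_one.trans_le hP)
  have hlead : ∀ᶠ i in (u : Filter I), Q.coeff P.natDegree i ≠ 0 := by
    rw [Ultrafilter.eventually_not]
    intro h
    have hP0 : P ≠ 0 := fun h0 => by simp [h0] at hn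
    apply Polynomial.leadingCoeff_ne_zero.2 hP0
    rw [Polynomial.leadingCoeff, Polynomial.coeff_map]
    exact Filter.Germ.coe_eq.2 h
  have hroot : ∀ᶠ i in (u : Filter I), ∃ z, (Q.map (Pi.evalRingHom (fun _ => K) i)).eval z = 0 := by
    filter_upwards [hlead] with i hi
    refine IsAlgClosed.exists_root _ (Polynomial.natDegree_pos_iff_degree_pos.1 ?_).ne'
    exact hn.trans_le (Polynomial.le_natDegree_of_ne_zero (by simpa [Polynomial.coeff_map] using hi))
  obtain ⟨x, hx⟩ := hroot.choice
  refine ⟨Filter.Germ.coeRingHom (u : Filter I) x, ?_⟩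
  rw [Polynomial.eval_map_apply]
  refine Filter.Germ.coe_eq.2 ?_
  filter_upwards [hx] with i hi
  exact (Polynomial.eval_map_apply (f := Pi.evalRingHom (fun _ => K) i) x).symm.trans hi

/-- The ultrapower `*ℂ = Germ u ℂ` of `ℂ` with respect to an ultrafilter `u` is
algebraically closed: every polynomial of degree at least 1 has a root. -/
theorem starC_algebraically_closed {I : Type*} [Nonempty I] (u : Ultrafilter I)
    (P : Polynomial (Filter.Germ (u : Filter I) ℂ)) (hP : 1 ≤ P.degree) :
    ∃ x : Filter.Germ (u : Filter I) ℂ, P.eval x = 0 :=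
  Filter.Germ.exists_eval_eq_zero u P hP
end

section
/- For every $d \ge 1$ and every $n \ge 1$ there exists a function $\varphi : \mathbb{R}^d \to \mathbb{R}$ such that: $\varphi$ is infinitely differentiable; $\varphi$ is symmetric, i.e. $\varphi(-x) = \varphi(x)$ for all $x$; $\varphi(x) = 0$ whenever $\lVert x \rVert \ge 1/n$; $\int_{\mathbb{R}^d} \varphi(x)\,dx = 1$; $\int_{\mathbb{R}^d} x^\alpha \varphi(x)\,dx = 0$ for every multi-index $\alpha \in \mathbb{N}_0^d$ with $1 \le |\alpha| \le n$; and $1 \le \int_{\mathbb{R}^d} |\varphi(x)|\,dx < 1 + 1/n$. (That is, each basic set $\mathcal{B}_n$ is nonempty.) -/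
open MeasureTheory Filter Topology

lemma integrable_continuous_mul_of_eq_zero_of_le_norm {E : Type*} [NormedAddCommGroup E]
    [ProperSpace E] [MeasurableSpace E] [BorelSpace E] (μ : Measure E)
    [IsFiniteMeasureOnCompacts μ] {φ g : E → ℝ} (hφ : Continuous φ) (hg : Continuous g) {r : ℝ}
    (hr : ∀ x, r ≤ ‖x‖ → φ x = 0) : Integrable (fun x => g x * φ x) μ := by
  refine (hg.mul hφ).integrable_of_hasCompactSupport ?_
  refine HasCompactSupport.intro (isCompact_closedBall (0 : E) r) fun x hx => ?_
  have hx' : r < ‖x‖ := by simpa using hx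
  simp [hr x hx'.le]

lemma integral_pow_mul_comp_smul {d : ℕ} (g : EuclideanSpace ℝ (Fin d) → ℝ) {R : ℝ} (hR : 0 < R) :
    ∫ x, R ^ d * g (R • x) = ∫ x, g x := by
  rw [integral_const_mul, Measure.integral_comp_smul]
  have h : 0 < R ^ d := pow_pos hR d
  simp only [finrank_euclideanSpace, Fintype.card_fin, smul_eq_mul]
  rw [abs_of_pos (inv_pos.2 h), mul_inv_cancel_left₀ h.ne']

/-- The dilation of `φ` by the factor `q`, keeping its integral. -/
noncomputable def dilation {d : ℕ} (q : ℝ) (φ : EuclideanSpace ℝ (Fin d) → ℝ) :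
    EuclideanSpace ℝ (Fin d) → ℝ :=
  fun x => q⁻¹ ^ d * φ (q⁻¹ • x)

lemma integral_monomial_mul_dilation {d : ℕ} (φ : EuclideanSpace ℝ (Fin d) → ℝ) {q : ℝ}
    (hq : 0 < q) (α : Fin d → ℕ) :
    ∫ x : EuclideanSpace ℝ (Fin d), (∏ i, x i ^ α i) * dilation q φ x =
      q ^ (∑ i, α i) * ∫ x : EuclideanSpace ℝ (Fin d), (∏ i, x i ^ α i) * φ x := by
  rw [← integral_pow_mul_comp_smul (fun x : EuclideanSpace ℝ (Fin d) => (∏ i, x i ^ α i) * φ x)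
    (inv_pos.2 hq), ← integral_const_mul]
  refine integral_congr_ae (.of_forall fun x => ?_)
  have h : ∏ i, (q⁻¹ • x) i ^ α i = (q ^ (∑ i, α i))⁻¹ * ∏ i, x i ^ α i := by
    simp only [PiLp.smul_apply, smul_eq_mul, mul_pow, Finset.prod_mul_distrib,
      Finset.prod_pow_eq_pow_sum, ← inv_pow]
  have h0 : q ^ (∑ i, α i) ≠ 0 := (pow_pos hq _).ne'
  simp only [dilation, h]
  field_simp

/-- Membership in the class of smooth even functions supported in the ball of radius `r`, with
integral `1`, with vanishing moments of orders `1, …, k` and with `L¹` norm below `C`. -/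
structure IsMollifierOfOrder {d : ℕ} (r C : ℝ) (k : ℕ) (φ : EuclideanSpace ℝ (Fin d) → ℝ) :
    Prop where
  contDiff : ContDiff ℝ (⊤ : ℕ∞) φ
  even : ∀ x, φ (-x) = φ x
  eq_zero : ∀ x, r ≤ ‖x‖ → φ x = 0
  integral_eq_one : ∫ x, φ x = 1
  moment_eq_zero : ∀ α : Fin d → ℕ, 1 ≤ ∑ i, α i → ∑ i, α i ≤ k →
    ∫ x : EuclideanSpace ℝ (Fin d), (∏ i, x i ^ α i) * φ x = 0
  integral_abs_lt : ∫ x, |φ x| < C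

lemma exists_isMollifierOfOrder_zero (d : ℕ) {r C : ℝ} (hr : 0 < r) (hC : 1 < C) :
    ∃ φ : EuclideanSpace ℝ (Fin d) → ℝ, IsMollifierOfOrder r C 0 φ := by
  let f : ContDiffBump (0 : EuclideanSpace ℝ (Fin d)) := ⟨r / 2, r, by positivity, by linarith⟩
  refine ⟨f.normed volume, f.contDiff_normed, fun x => f.normed_neg x, fun x hx => ?_,
    f.integral_normed, fun α h1 h2 => by omega, ?_⟩
  · rw [← Function.notMem_support, f.support_normed_eq]
    simpa using hx
  · simpa only [abs_of_nonneg (f.nonneg_normed _), f.integral_normed] using hC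

lemma exists_pow_factor_mul_lt {A C : ℝ} (h : A < C) {k : ℕ} (hk : k ≠ 0) :
    ∃ q : ℝ, 0 < q ∧ q < 1 ∧ (1 + q ^ k) / (1 - q ^ k) * A < C := by
  have hc : ContinuousAt (fun q : ℝ => (1 + q ^ k) / (1 - q ^ k) * A) 0 := by
    refine ContinuousAt.mul (ContinuousAt.div (by fun_prop) (by fun_prop) ?_) (by fun_prop)
    simp [hk]
  have hev : ∀ᶠ q in 𝓝[>] (0 : ℝ), (1 + q ^ k) / (1 - q ^ k) * A < C :=
    (hc.eventually_lt_const (by simpa [hk] using h)).filter_mono nhdsWithin_le_nhds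
  obtain ⟨q, hq, h0, h1⟩ := (hev.and (Ioo_mem_nhdsGT zero_lt_one)).exists
  exact ⟨q, h0, h1, hq⟩

lemma IsMollifierOfOrder.exists_succ {d k : ℕ} {r C : ℝ} {φ : EuclideanSpace ℝ (Fin d) → ℝ}
    (h : IsMollifierOfOrder r C k φ) :
    ∃ ψ : EuclideanSpace ℝ (Fin d) → ℝ, IsMollifierOfOrder r C (k + 1) ψ := by
  obtain ⟨q, hq0, hq1, hqC⟩ := exists_pow_factor_mul_lt h.integral_abs_lt k.succ_ne_zero
  set s := q ^ (k + 1) with hs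
  have hs0 : 0 < s := pow_pos hq0 _
  have hs1 : 0 < 1 - s := sub_pos.2 (pow_lt_one₀ hq0.le hq1 k.succ_ne_zero)
  have hdil : ContDiff ℝ (⊤ : ℕ∞) (dilation q φ) :=
    contDiff_const.mul (h.contDiff.comp (contDiff_const_smul _))
  have hdil0 : ∀ x, r ≤ ‖x‖ → dilation q φ x = 0 := fun x hx => by
    have hle : ‖x‖ ≤ ‖q⁻¹ • x‖ := by
      rw [norm_smul, Real.norm_of_nonneg (inv_pos.2 hq0).le]
      exact le_mul_of_one_le_left (norm_nonneg _) ((one_le_inv₀ hq0).2 hq1.le)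
    simp [dilation, h.eq_zero _ (hx.trans hle)]
  have hmoment : ∀ α : Fin d → ℕ,
      ∫ x : EuclideanSpace ℝ (Fin d),
        (∏ i, x i ^ α i) * ((dilation q φ x - s * φ x) / (1 - s)) =
      (q ^ (∑ i, α i) - s) / (1 - s) *
        ∫ x : EuclideanSpace ℝ (Fin d), (∏ i, x i ^ α i) * φ x := fun α => by
    have hmon : Continuous fun x : EuclideanSpace ℝ (Fin d) => ∏ i, x i ^ α i := by fun_prop
    have e : ∀ x : EuclideanSpace ℝ (Fin d),
        (∏ i, x i ^ α i) * ((dilation q φ x - s * φ x) / (1 - s)) =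
        (1 - s)⁻¹ * ((∏ i, x i ^ α i) * dilation q φ x - s * ((∏ i, x i ^ α i) * φ x)) :=
      fun x => by ring
    simp_rw [e]
    rw [integral_const_mul, integral_sub
      (integrable_continuous_mul_of_eq_zero_of_le_norm _ hdil.continuous hmon hdil0)
      ((integrable_continuous_mul_of_eq_zero_of_le_norm _ h.contDiff.continuous hmon
        h.eq_zero).const_mul s), integral_const_mul, integral_monomial_mul_dilation φ hq0]
    ring
  refine ⟨fun x => (dilation q φ x - s * φ x) / (1 - s),
    (hdil.sub (contDiff_const.mul h.contDiff)).div_const _,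
    fun x => by simp only [dilation, smul_neg, h.even],
    fun x hx => by simp [hdil0 x hx, h.eq_zero x hx], ?_, fun α h1 h2 => ?_, ?_⟩
  · simpa [h.integral_eq_one, hs1.ne'] using hmoment 0
  · rw [hmoment]
    rcases Nat.lt_or_ge k (∑ i, α i) with hlt | hge
    · rw [le_antisymm h2 hlt, ← hs]
      simp
    · rw [h.moment_eq_zero α h1 hge, mul_zero]
  · refine lt_of_le_of_lt ?_ hqC
    have hφ_int : Integrable (fun x => |φ x|) := by
      simpa using (integrable_continuous_mul_of_eq_zero_of_le_norm volume h.contDiff.continuous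
        (continuous_const (y := (1 : ℝ))) h.eq_zero).abs
    have hdil_int : Integrable (fun x => |dilation q φ x|) := by
      simpa using (integrable_continuous_mul_of_eq_zero_of_le_norm volume hdil.continuous
        (continuous_const (y := (1 : ℝ))) hdil0).abs
    have habs : ∫ x, |dilation q φ x| = ∫ x, |φ x| := by
      rw [← integral_pow_mul_comp_smul (fun x => |φ x|) (inv_pos.2 hq0)]
      simp only [dilation, abs_mul, abs_of_pos (pow_pos (inv_pos.2 hq0) d)]
    calc ∫ x, |(dilation q φ x - s * φ x) / (1 - s)|
        ≤ ∫ x, (1 - s)⁻¹ * (|dilation q φ x| + s * |φ x|) := by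
          refine integral_mono_of_nonneg (.of_forall fun x => abs_nonneg _)
            ((hdil_int.add (hφ_int.const_mul s)).const_mul _) (.of_forall fun x => ?_)
          have htri : |dilation q φ x - s * φ x| ≤ |dilation q φ x| + s * |φ x| := by
            simpa [abs_mul, abs_of_pos hs0] using abs_sub (dilation q φ x) (s * φ x)
          calc |(dilation q φ x - s * φ x) / (1 - s)|
              = (1 - s)⁻¹ * |dilation q φ x - s * φ x| := by
                rw [abs_div, abs_of_pos hs1, div_eq_inv_mul]
            _ ≤ (1 - s)⁻¹ * (|dilation q φ x| + s * |φ x|) := by gcongr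
      _ = (1 + s) / (1 - s) * ∫ x, |φ x| := by
          rw [integral_const_mul, integral_add hdil_int (hφ_int.const_mul s),
            integral_const_mul, habs]
          ring

lemma exists_isMollifierOfOrder (d k : ℕ) {r C : ℝ} (hr : 0 < r) (hC : 1 < C) :
    ∃ φ : EuclideanSpace ℝ (Fin d) → ℝ, IsMollifierOfOrder r C k φ := by
  induction k with
  | zero => exact exists_isMollifierOfOrder_zero d hr hC
  | succ k ih => exact ih.elim fun _ h => h.exists_succ

/-- Each basic set `𝓑ₙ` is nonempty: there is a real-valued symmetric test function
supported in the ball of radius `1/n`, with integral `1`, vanishing moments up to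
order `n`, and `1 ≤ ∫|φ| < 1 + 1/n`. -/
theorem basic_set_nonempty (d n : ℕ) (hd : 1 ≤ d) (hn : 1 ≤ n) :
    ∃ φ : EuclideanSpace ℝ (Fin d) → ℝ,
      ContDiff ℝ (⊤ : ℕ∞) φ ∧
      (∀ x, φ (-x) = φ x) ∧
      (∀ x : EuclideanSpace ℝ (Fin d), (1 : ℝ) / n ≤ ‖x‖ → φ x = 0) ∧
      (∫ x, φ x) = 1 ∧
      (∀ α : Fin d → ℕ, 1 ≤ ∑ i, α i → ∑ i, α i ≤ n →
        (∫ x : EuclideanSpace ℝ (Fin d), (∏ i, x i ^ α i) * φ x) = 0) ∧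
      (1 ≤ ∫ x, |φ x|) ∧ (∫ x, |φ x|) < 1 + 1 / n := by
  have hn0 : (0 : ℝ) < 1 / n := by positivity
  obtain ⟨φ, h⟩ := exists_isMollifierOfOrder d n hn0 (lt_add_of_pos_right 1 hn0)
  refine ⟨φ, h.contDiff, h.even, h.eq_zero, h.integral_eq_one, h.moment_eq_zero, ?_,
    h.integral_abs_lt⟩
  calc (1 : ℝ) = |∫ x, φ x| := by rw [h.integral_eq_one, abs_one]
    _ ≤ ∫ x, |φ x| := abs_integral_le_integral_abs
end

section
/- Let $f : \mathbb{R}^d \to \mathbb{R}$ be infinitely differentiable, let $K \subseteq \mathbb{R}^d$ be compact, and let $n \in \mathbb{N}$. Then there exists a constant $C > 0$ (depending only on $f$, $K$, $n$) such that: for every real $r$ with $0 < r \le 1$ and every infinitely differentiable $\varphi : \mathbb{R}^d \to \mathbb{R}$ with support contained in the closed ball of radius $r$ about $0$, satisfying $\int \varphi = 1$, $\int t^\alpha \varphi(t)\,dt = 0$ for all multi-indices $\alpha$ with $1 \le |\alpha| \le n$, and $\int |\varphi| \le 2$, one has $\sup_{x \in K} |(f * \varphi)(x) - f(x)| \le C\,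 r^{\,n+1}$. -/
open MeasureTheory

section Taylor

variable {E : Type*} [NormedAddCommGroup E] [NormedSpace ℝ E]

theorem iteratedDeriv_comp_add_smul {f : E → ℝ} (hf : ContDiff ℝ (⊤ : ℕ∞) f) (x v : E)
    (k : ℕ) (s : ℝ) :
    iteratedDeriv k (fun s : ℝ => f (x + s • v)) s =
      iteratedFDeriv ℝ k f (x + s • v) (fun _ => v) := by
  have h : (fun s : ℝ => f (x + s • v)) =
      (fun y => f (x + y)) ∘ (ContinuousLinearMap.toSpanSingleton ℝ v) := by
    ext s
    simp
  have hg : ContDiff ℝ (⊤ : ℕ∞) (fun y => f (x + y)) := by fun_prop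
  rw [iteratedDeriv_eq_iteratedFDeriv, h,
    ContinuousLinearMap.iteratedFDeriv_comp_right _ hg s (i := k)
      (by exact_mod_cast le_top),
    ContinuousMultilinearMap.compContinuousLinearMap_apply, iteratedFDeriv_comp_add_left]
  simp

/-- Taylor's formula for a smooth function along a segment, with a bound on the remainder. -/
theorem abs_sub_taylor_le {f : E → ℝ} (hf : ContDiff ℝ (⊤ : ℕ∞) f) (n : ℕ) (x v : E) {M : ℝ}
    (hM : ∀ s ∈ Set.Icc (0 : ℝ) 1, ‖iteratedFDeriv ℝ (n + 1) f (x + s • v)‖ ≤ M) :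
    |f (x + v) - ∑ k ∈ Finset.range (n + 1),
      (k.factorial : ℝ)⁻¹ * iteratedFDeriv ℝ k f x (fun _ => v)| ≤ M * ‖v‖ ^ (n + 1) := by
  have hM0 : 0 ≤ M := (norm_nonneg _).trans (hM 0 (by simp))
  have hg : ContDiff ℝ (⊤ : ℕ∞) (fun s : ℝ => f (x + s • v)) := by fun_prop
  have hD (k : ℕ) (s : ℝ) (hs : s ∈ Set.Icc (0 : ℝ) 1) :
      iteratedDerivWithin k (fun s : ℝ => f (x + s • v)) (Set.Icc 0 1) s =
        iteratedFDeriv ℝ k f (x + s • v) (fun _ => v) := by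
    rw [iteratedDerivWithin_eq_iteratedDeriv (uniqueDiffOn_Icc one_pos)
      (hg.contDiffAt.of_le (by exact_mod_cast le_top)) hs, iteratedDeriv_comp_add_smul hf]
  have key := taylor_mean_remainder_bound (f := fun s : ℝ => f (x + s • v)) (n := n)
    (C := M * ‖v‖ ^ (n + 1)) zero_le_one
    ((hg.of_le (by exact_mod_cast le_top)).contDiffOn) (Set.right_mem_Icc.2 zero_le_one) (by
      intro s hs
      rw [hD _ _ hs]
      refine (ContinuousMultilinearMap.le_opNorm _ _).trans ?_
      simp only [Finset.prod_const, Finset.card_univ, Fintype.card_fin]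
      gcongr
      exact hM s hs)
  rw [taylor_within_apply] at key
  simp only [hD _ _ (Set.left_mem_Icc.2 zero_le_one)] at key
  simp only [one_smul, zero_smul, add_zero, sub_zero, one_pow, mul_one, smul_eq_mul,
    Real.norm_eq_abs] at key
  exact key.trans (div_le_self (by positivity) (by exact_mod_cast n.factorial_pos))

end Taylor

theorem integral_multilinear_mul_eq_zero {d k : ℕ}
    (A : ContinuousMultilinearMap ℝ (fun _ : Fin k => EuclideanSpace ℝ (Fin d)) ℝ)
    {φ : EuclideanSpace ℝ (Fin d) → ℝ} (hφ : Continuous φ) (hc : HasCompactSupport φ)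
    (hmom : ∀ α : Fin d → ℕ, ∑ i, α i = k →
      (∫ t : EuclideanSpace ℝ (Fin d), (∏ i, t i ^ α i) * φ t) = 0) :
    ∫ t, A (fun _ => -t) * φ t = 0 := by
  have hA (t : EuclideanSpace ℝ (Fin d)) : A (fun _ => -t) * φ t =
      ∑ r : Fin k → Fin d, ((-1) ^ k * A (fun j => EuclideanSpace.basisFun (Fin d) ℝ (r j))) *
        ((∏ i, t i ^ (Finset.univ.filter (fun j => r j = i)).card) * φ t) := by
    have ht : -t = ∑ i, (-t i) • EuclideanSpace.basisFun (Fin d) ℝ i := by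
      conv_lhs => rw [← (EuclideanSpace.basisFun (Fin d) ℝ).sum_repr (-t)]
      rfl
    rw [ht, ContinuousMultilinearMap.map_sum, Finset.sum_mul]
    refine Finset.sum_congr rfl fun r _ => ?_
    have hp : ∏ j, t (r j) = ∏ i, t i ^ (Finset.univ.filter (fun j => r j = i)).card := by
      rw [← Finset.prod_fiberwise' Finset.univ r (fun i => t i)]
      simp
    rw [ContinuousMultilinearMap.map_smul_univ, Finset.prod_neg, hp]
    simp only [Finset.card_univ, Fintype.card_fin, smul_eq_mul]
    ring
  simp only [hA]
  rw [integral_finsetSum]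
  · refine Finset.sum_eq_zero fun r _ => ?_
    rw [integral_const_mul, hmom, mul_zero]
    rw [← Finset.card_eq_sum_card_fiberwise (fun _ _ => Finset.mem_coe.2 (Finset.mem_univ _))]
    simp
  · intro r _
    refine Continuous.integrable_of_hasCompactSupport (by fun_prop) ?_
    exact (hc.mul_left).mul_left

/-- Key estimate for the embedding of `𝓔(ℝᵈ)`: for smooth `f`, compact `K` and `n ∈ ℕ`
there is a constant `C > 0` such that for every `0 < r ≤ 1` and every test function `φ`
supported in the ball of radius `r`, with `∫φ = 1`, vanishing moments up to order `n`
and `∫|φ| ≤ 2`, one has `sup_{x ∈ K} |(f * φ)(x) - f(x)| ≤ C rⁿ⁺¹`. -/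
theorem smooth_convolution_estimate (d n : ℕ) (f : EuclideanSpace ℝ (Fin d) → ℝ)
    (hf : ContDiff ℝ (⊤ : ℕ∞) f) (K : Set (EuclideanSpace ℝ (Fin d))) (hK : IsCompact K) :
    ∃ C : ℝ, 0 < C ∧ ∀ r : ℝ, 0 < r → r ≤ 1 →
      ∀ φ : EuclideanSpace ℝ (Fin d) → ℝ, ContDiff ℝ (⊤ : ℕ∞) φ →
        Function.support φ ⊆ Metric.closedBall 0 r →
        (∫ t, φ t) = 1 →
        (∀ α : Fin d → ℕ, 1 ≤ ∑ i, α i → ∑ i, α i ≤ n →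
          (∫ t : EuclideanSpace ℝ (Fin d), (∏ i, t i ^ α i) * φ t) = 0) →
        (∫ t, |φ t|) ≤ 2 →
        ∀ x ∈ K, |(∫ t, f (x - t) * φ t) - f x| ≤ C * r ^ (n + 1) := by
  have hcont : Continuous (iteratedFDeriv ℝ (n + 1) f) :=
    hf.continuous_iteratedFDeriv (by exact_mod_cast le_top)
  obtain ⟨M, hM⟩ := (hK.cthickening (r := 1)).exists_bound_of_continuousOn hcont.continuousOn
  refine ⟨2 * max M 1, by positivity, ?_⟩
  intro r hr hr1 φ hφ hsupp hint hmom habs x hx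
  have hφc : Continuous φ := hφ.continuous
  have hfc : Continuous f := hf.continuous
  have hcs : HasCompactSupport φ :=
    HasCompactSupport.of_support_subset_isCompact (isCompact_closedBall 0 r) hsupp
  let P : EuclideanSpace ℝ (Fin d) → ℝ := fun t => ∑ k ∈ Finset.range (n + 1),
    (k.factorial : ℝ)⁻¹ * iteratedFDeriv ℝ k f x (fun _ => -t)
  have hPc : Continuous P := by
    refine continuous_finsetSum _ fun k _ => continuous_const.mul ?_
    exact (iteratedFDeriv ℝ k f x).cont.comp (by fun_prop)
  have hI {g : EuclideanSpace ℝ (Fin d) → ℝ} (hg : Continuous g) :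
      Integrable (fun t => g t * φ t) :=
    (hg.mul hφc).integrable_of_hasCompactSupport hcs.mul_left
  have hP : ∫ t, P t * φ t = f x := by
    have hterm (k : ℕ) : Integrable (fun t =>
        ((k.factorial : ℝ)⁻¹ * iteratedFDeriv ℝ k f x (fun _ => -t)) * φ t) :=
      hI (continuous_const.mul ((iteratedFDeriv ℝ k f x).cont.comp (by fun_prop)))
    simp only [P, Finset.sum_mul]
    rw [integral_finsetSum _ fun k _ => hterm k, Finset.sum_range_succ', Finset.sum_eq_zero]
    · simp [integral_const_mul, hint]
    · intro k hk
      simp only [mul_assoc]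
      rw [integral_const_mul, integral_multilinear_mul_eq_zero _ hφc hcs, mul_zero]
      intro α hα
      have := Finset.mem_range.1 hk
      exact hmom α (by omega) (by omega)
  rw [← hP, ← integral_sub (hI (by fun_prop : Continuous fun t => f (x - t))) (hI hPc)]
  have hpt (t : EuclideanSpace ℝ (Fin d)) :
      ‖f (x - t) * φ t - P t * φ t‖ ≤ (max M 1 * r ^ (n + 1)) * |φ t| := by
    rw [← sub_mul, norm_mul, Real.norm_eq_abs, Real.norm_eq_abs]
    by_cases h0 : φ t = 0
    · simp [h0]
    have ht : ‖t‖ ≤ r := mem_closedBall_zero_iff.1 (hsupp h0)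
    gcongr
    have key := abs_sub_taylor_le hf n x (-t) (M := max M 1) (by
      intro s hs
      refine (hM _ ?_).trans (le_max_left _ _)
      refine Metric.mem_cthickening_of_dist_le _ x _ _ hx ?_
      rw [dist_eq_norm, add_sub_cancel_left, norm_smul, norm_neg, Real.norm_of_nonneg hs.1]
      exact mul_le_one₀ hs.2 (norm_nonneg _) (ht.trans hr1))
    rw [← sub_eq_add_neg, norm_neg] at key
    exact key.trans (by gcongr)
  have hIabs : Integrable (fun t => |φ t|) :=
    (hφc.integrable_of_hasCompactSupport hcs).abs
  calc _ ≤ ∫ t, (max M 1 * r ^ (n + 1)) * |φ t| :=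
        norm_integral_le_of_norm_le (hIabs.const_mul _) (Filter.Eventually.of_forall hpt)
    _ = (max M 1 * r ^ (n + 1)) * ∫ t, |φ t| := integral_const_mul _ _
    _ ≤ (max M 1 * r ^ (n + 1)) * 2 := by gcongr
    _ = _ := by ring
end

section
/- Let $f : \mathbb{R} \to \mathbb{R}$ be a Schwartz function, $k \in \mathbb{R}$, $n \in \mathbb{N}$, and set $g(x) = f(x - k)$. If for every $j \le n$ one has $\Big(\int f(x)^2\,dx\Big)\Big(\int f(x)\,x^j\,dx\Big) = \int f(x)^2\,x^j\,dx$, then for every $j \le n$ one also has $\Big(\int g(x)^2\,dx\Big)\Big(\int g(x)\,x^j\,dx\Big) = \int g(x)^2\,x^j\,dx$. -/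
open MeasureTheory Finset

theorem SchwartzMap.integrable_mul_pow (f : SchwartzMap ℝ ℝ) (j : ℕ) :
    Integrable fun x => f x * x ^ j := by
  refine (f.integrable_pow_mul volume j).mono' (by fun_prop) (.of_forall fun x => ?_)
  rw [norm_mul, norm_pow, mul_comm]

theorem SchwartzMap.integrable_sq_mul_pow (f : SchwartzMap ℝ ℝ) (j : ℕ) :
    Integrable fun x => f x ^ 2 * x ^ j := by
  simp_rw [sq, mul_assoc]
  exact (f.integrable_mul_pow j).mul_of_top_right (f.memLp_top volume)

theorem integral_comp_sub_mul_pow {h : ℝ → ℝ} {j : ℕ}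
    (hh : ∀ i ≤ j, Integrable fun x => h x * x ^ i) (k : ℝ) :
    ∫ x, h (x - k) * x ^ j =
      ∑ i ∈ range (j + 1), k ^ (j - i) * j.choose i * ∫ x, h x * x ^ i := by
  calc ∫ x, h (x - k) * x ^ j = ∫ x, h x * (x + k) ^ j := by
        simpa using integral_sub_right_eq_self (μ := volume) (fun x => h x * (x + k) ^ j) k
    _ = ∫ x, ∑ i ∈ range (j + 1), k ^ (j - i) * j.choose i * (h x * x ^ i) := by
        congr 1 with x
        rw [add_pow, mul_sum]
        exact sum_congr rfl fun i _ => by ring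
    _ = _ := by
        rw [integral_finsetSum _ fun i hi => (hh i (mem_range_succ_iff.mp hi)).const_mul _]
        simp_rw [integral_const_mul]


/-- The moment conditions defining the profile sets `Sₘ` are invariant under
translation: if a Schwartz function `f` satisfies
`(∫f²)(∫f xʲ) = ∫f² xʲ` for all `j ≤ n`, then so does `g(x) = f(x - k)`. -/
theorem moment_conditions_translation_invariant (f : SchwartzMap ℝ ℝ) (k : ℝ) (n : ℕ)
    (g : ℝ → ℝ) (hg : ∀ x, g x = f (x - k))
    (hf : ∀ j ≤ n, (∫ x, f x ^ 2) * (∫ x, f x * x ^ j) = ∫ x, f x ^ 2 * x ^ j) :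
    ∀ j ≤ n, (∫ x, g x ^ 2) * (∫ x, g x * x ^ j) = ∫ x, g x ^ 2 * x ^ j := by
  intro j hj
  simp_rw [hg]
  rw [integral_sub_right_eq_self (fun x => f x ^ 2) k,
    integral_comp_sub_mul_pow (fun i _ => f.integrable_mul_pow i),
    integral_comp_sub_mul_pow (h := fun x => f x ^ 2) (fun i _ => f.integrable_sq_mul_pow i),
    mul_sum]
  refine sum_congr rfl fun i hi => ?_
  rw [← hf i ((mem_range_succ_iff.mp hi).trans hj)]
  ring
end
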